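/- Let (Y,Z) be a dual pair, C, D ⊆ Y weakly closed cones and B₁, B₂ ⊆ Y weakly closed convex sets containing zero. If B₂° + C° is weak*-closed in Z, then Y is additive with respect to (C,D,B₁,B₂) (i.e., (B₂ ∩ C) + D ⊆ B₁) if and only if Z is coadditive with respect to (C°,D°,B₁°,B₂°) (i.e., B₁° ⊆ (B₂° + C°) ∩ D°). -/

import Mathlib

open Pointwise

/-- The one-sided polar of a subset `A ⊆ Y` in the dual pair `(Y,Z)` given by `B`. -/
def onesidedPolar {Y Z : Type*} [AddCommGroup Y] [Module ℝ Y] [AddCommGroup Z] [Module ℝ Z]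
    (B : Y →ₗ[ℝ] Z →ₗ[ℝ] ℝ) (A : Set Y) : Set Z :=
  {z : Z | ∀ a ∈ A, B a z ≤ 1}

theorem exists_mem_onesidedPolar_one_lt {Y Z : Type*} [AddCommGroup Y] [Module ℝ Y]
    [AddCommGroup Z] [Module ℝ Z] (B : Y →ₗ[ℝ] Z →ₗ[ℝ] ℝ) {A : Set Y}
    (hcl : IsClosed (X := WeakBilin B) A) (hconv : Convex ℝ A) (h0 : (0 : Y) ∈ A)
    {x : Y} (hx : x ∉ A) : ∃ z ∈ onesidedPolar B A, 1 < B x z := by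
  obtain ⟨f, u, hfA, hfx⟩ := geometric_hahn_banach_closed_point (E := WeakBilin B) hconv hcl hx
  obtain ⟨z, rfl⟩ := LinearMap.dualEmbedding_surjective B f
  replace hfA : ∀ a ∈ A, B a z < u := hfA
  replace hfx : u < B x z := hfx
  have hu : 0 < u := by simpa using hfA 0 h0
  refine ⟨u⁻¹ • z, fun a ha ↦ ?_, ?_⟩
  · rw [map_smul, smul_eq_mul, inv_mul_le_one₀ hu]
    exact (hfA a ha).le
  · rwa [map_smul, smul_eq_mul, lt_inv_mul_iff₀ hu, mul_one]

/-- Bipolar theorem, in pointwise form. -/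
theorem mem_of_forall_mem_onesidedPolar_le_one {Y Z : Type*} [AddCommGroup Y] [Module ℝ Y]
    [AddCommGroup Z] [Module ℝ Z] (B : Y →ₗ[ℝ] Z →ₗ[ℝ] ℝ) {A : Set Y}
    (hcl : IsClosed (X := WeakBilin B) A) (hconv : Convex ℝ A) (h0 : (0 : Y) ∈ A)
    {x : Y} (hx : ∀ z ∈ onesidedPolar B A, B x z ≤ 1) : x ∈ A := by
  by_contra hxA
  obtain ⟨z, hz, hlt⟩ := exists_mem_onesidedPolar_one_lt B hcl hconv h0 hxA
  exact (hx z hz).not_gt hlt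

theorem zero_mem_onesidedPolar {Y Z : Type*} [AddCommGroup Y] [Module ℝ Y]
    [AddCommGroup Z] [Module ℝ Z] (B : Y →ₗ[ℝ] Z →ₗ[ℝ] ℝ) (A : Set Y) :
    (0 : Z) ∈ onesidedPolar B A := fun a _ ↦ by simp

theorem convex_onesidedPolar {Y Z : Type*} [AddCommGroup Y] [Module ℝ Y]
    [AddCommGroup Z] [Module ℝ Z] (B : Y →ₗ[ℝ] Z →ₗ[ℝ] ℝ) (A : Set Y) :
    Convex ℝ (onesidedPolar B A) := by
  intro z hz w hw s t hs ht hst a ha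
  simp only [map_add, map_smul, smul_eq_mul]
  nlinarith [mul_le_mul_of_nonneg_left (hz a ha) hs, mul_le_mul_of_nonneg_left (hw a ha) ht]

theorem nonpos_of_mem_onesidedPolar {Y Z : Type*} [AddCommGroup Y] [Module ℝ Y]
    [AddCommGroup Z] [Module ℝ Z] (B : Y →ₗ[ℝ] Z →ₗ[ℝ] ℝ) {K : Set Y}
    (hK : ∀ l : ℝ, 0 ≤ l → l • K ⊆ K) {y : Y} (hy : y ∈ K) {z : Z}
    (hz : z ∈ onesidedPolar B K) : B y z ≤ 0 := by
  by_contra! hpos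
  have h := hz _ (hK (2 / B y z) (by positivity) (Set.smul_mem_smul_set hy))
  rw [map_smul, LinearMap.smul_apply, smul_eq_mul, div_mul_cancel₀ _ hpos.ne'] at h
  norm_num at h

theorem zero_mem_of_smul_subset {Y : Type*} [AddCommGroup Y] [Module ℝ Y] {K : Set Y}
    (hne : K.Nonempty) (hK : ∀ l : ℝ, 0 ≤ l → l • K ⊆ K) : (0 : Y) ∈ K := by
  obtain ⟨y, hy⟩ := hne
  simpa using hK 0 le_rfl (Set.smul_mem_smul_set hy)

theorem convex_of_add_subset_of_smul_subset {Y : Type*} [AddCommGroup Y] [Module ℝ Y] {K : Set Y}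
    (hadd : K + K ⊆ K) (hK : ∀ l : ℝ, 0 ≤ l → l • K ⊆ K) : Convex ℝ K :=
  fun _ hx _ hy s t hs ht _ ↦ hadd (Set.add_mem_add
    (hK s hs (Set.smul_mem_smul_set hx)) (hK t ht (Set.smul_mem_smul_set hy)))

/-- If `B₂° + C°` is weak*-closed, then `Y` is additive w.r.t.
`(C,D,B₁,B₂)` (i.e. `(B₂ ∩ C) + D ⊆ B₁`) iff `Z` is coadditive w.r.t.
`(C°,D°,B₁°,B₂°)` (i.e. `B₁° ⊆ (B₂° + C°) ∩ D°`). -/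
theorem additive_iff_coadditive_polars
    {Y Z : Type*} [AddCommGroup Y] [Module ℝ Y] [AddCommGroup Z] [Module ℝ Z]
    (B : Y →ₗ[ℝ] Z →ₗ[ℝ] ℝ)
    (hsepY : ∀ y : Y, (∀ z : Z, B y z = 0) → y = 0)
    (hsepZ : ∀ z : Z, (∀ y : Y, B y z = 0) → z = 0)
    (C D B₁ B₂ : Set Y)
    (hCcl : IsClosed (X := WeakBilin B) C) (hCne : C.Nonempty)
    (hCadd : C + C ⊆ C) (hCsmul : ∀ l : ℝ, 0 ≤ l → l • C ⊆ C)
    (hDcl : IsClosed (X := WeakBilin B) D) (hDne : D.Nonempty)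
    (hDadd : D + D ⊆ D) (hDsmul : ∀ l : ℝ, 0 ≤ l → l • D ⊆ D)
    (hB₁cl : IsClosed (X := WeakBilin B) B₁) (hB₁conv : Convex ℝ B₁) (hB₁0 : (0 : Y) ∈ B₁)
    (hB₂cl : IsClosed (X := WeakBilin B) B₂) (hB₂conv : Convex ℝ B₂) (hB₂0 : (0 : Y) ∈ B₂)
    (hcl : IsClosed (X := WeakBilin B.flip) (onesidedPolar B B₂ + onesidedPolar B C)) :
    (B₂ ∩ C) + D ⊆ B₁ ↔
      onesidedPolar B B₁ ⊆ (onesidedPolar B B₂ + onesidedPolar B C) ∩ onesidedPolar B D := by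
  have hC0 : (0 : Y) ∈ C := zero_mem_of_smul_subset hCne hCsmul
  have hD0 : (0 : Y) ∈ D := zero_mem_of_smul_subset hDne hDsmul
  have hCconv : Convex ℝ C := convex_of_add_subset_of_smul_subset hCadd hCsmul
  constructor
  · intro h z hz
    refine ⟨?_, fun d hd ↦ hz d (h ⟨0, ⟨hB₂0, hC0⟩, d, hd, zero_add d⟩)⟩
    refine mem_of_forall_mem_onesidedPolar_le_one B.flip hcl
      ((convex_onesidedPolar B B₂).add (convex_onesidedPolar B C))
      ⟨0, zero_mem_onesidedPolar B B₂, 0, zero_mem_onesidedPolar B C, add_zero 0⟩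
      fun y hy ↦ hz y (h ⟨y, ⟨?_, ?_⟩, 0, hD0, add_zero y⟩)
    · exact mem_of_forall_mem_onesidedPolar_le_one B hB₂cl hB₂conv hB₂0 fun w hw ↦
        hy w ⟨w, hw, 0, zero_mem_onesidedPolar B C, add_zero w⟩
    · exact mem_of_forall_mem_onesidedPolar_le_one B hCcl hCconv hC0 fun w hw ↦
        hy w ⟨0, zero_mem_onesidedPolar B B₂, w, hw, zero_add w⟩
  · rintro h _ ⟨b, ⟨hb, hbC⟩, d, hd, rfl⟩
    refine mem_of_forall_mem_onesidedPolar_le_one B hB₁cl hB₁conv hB₁0 fun z hz ↦ ?_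
    obtain ⟨⟨u, hu, v, hv, rfl⟩, hzD⟩ := h hz
    have hbu : B b u ≤ 1 := hu b hb
    have hbv : B b v ≤ 0 := nonpos_of_mem_onesidedPolar B hCsmul hbC hv
    have hdz : B d (u + v) ≤ 0 := nonpos_of_mem_onesidedPolar B hDsmul hd hzD
    simp only [map_add, LinearMap.add_apply] at hdz ⊢
    linarith
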